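/- Let q > 1, 0 < α ≤ 1, λ ∈ ℝ, a(k) = ∏_{m=0}^{k-1} (q^{-mα-1} - 1), and define y(t) = λ · ∑_{k=0}^∞ a(k) t^{kα}/Γ(kα+1) for t ≥ 0. Then y satisfies the Volterra integral equation equivalent to the fractional Ambartsumian equation: for every t ≥ 0, y(t) = λ - (1/Γ(α)) ∫_0^t (t - s)^{α-1} y(s) ds + (1/(q·Γ(α))) ∫_0^t (t - s)^{α-1} y(s/q) ds. -/

import Mathlib

/-- Cutting the Euler integral off at `A` bounds the Gamma function below by an exponential. -/
theorem rpow_mul_exp_neg_le_Gamma_add_one {A x : ℝ} (hA : 0 < A) (hx : 0 ≤ x) :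
    A ^ x * Real.exp (-A) ≤ Real.Gamma (x + 1) := by
  have hint := Real.GammaIntegral_convergent (s := x + 1) (by linarith)
  have hsub : Set.Ioi A ⊆ Set.Ioi (0 : ℝ) := Set.Ioi_subset_Ioi hA.le
  rw [Real.Gamma_eq_integral (by linarith), ← integral_exp_neg_Ioi A,
    ← MeasureTheory.integral_const_mul]
  calc ∫ s in Set.Ioi A, A ^ x * Real.exp (-s)
      ≤ ∫ s in Set.Ioi A, Real.exp (-s) * s ^ (x + 1 - 1) := by
        refine MeasureTheory.setIntegral_mono_on ((exp_neg_integrableOn_Ioi A one_pos).congr_fun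
          (fun s _ => by simp) measurableSet_Ioi |>.const_mul _)
          (hint.mono_set hsub) measurableSet_Ioi fun s hs => ?_
        rw [add_sub_cancel_right, mul_comm]
        gcongr
        exact (Set.mem_Ioi.mp hs).le
    _ ≤ ∫ s in Set.Ioi (0 : ℝ), Real.exp (-s) * s ^ (x + 1 - 1) := by
        refine MeasureTheory.setIntegral_mono_set hint ?_ hsub.eventuallyLE
        filter_upwards [MeasureTheory.ae_restrict_mem measurableSet_Ioi] with s hs
        have : 0 < s := hs
        simp only [Pi.zero_apply]
        positivity

/-- The Mittag-Leffler series converges. -/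
theorem summable_rpow_div_Gamma {α t : ℝ} (hα : 0 < α) (ht : 0 ≤ t) :
    Summable fun k : ℕ => t ^ ((k : ℝ) * α) / Real.Gamma ((k : ℝ) * α + 1) := by
  have hA : 0 < t + 1 := by linarith
  have hr : (t / (t + 1)) ^ α < 1 :=
    Real.rpow_lt_one (by positivity) ((div_lt_one hA).2 (by linarith)) hα
  refine Summable.of_nonneg_of_le (fun k => ?_) (fun k => ?_)
    ((summable_geometric_of_lt_one (by positivity) hr).mul_left (Real.exp (t + 1)))
  · have := Real.Gamma_pos_of_pos (show 0 < (k : ℝ) * α + 1 by positivity)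
    positivity
  · have hle := rpow_mul_exp_neg_le_Gamma_add_one hA (show 0 ≤ (k : ℝ) * α by positivity)
    calc t ^ ((k : ℝ) * α) / Real.Gamma ((k : ℝ) * α + 1)
        ≤ t ^ ((k : ℝ) * α) / ((t + 1) ^ ((k : ℝ) * α) * Real.exp (-(t + 1))) := by gcongr
      _ = Real.exp (t + 1) * ((t / (t + 1)) ^ α) ^ k := by
        rw [← Real.rpow_mul_natCast (by positivity), mul_comm α, Real.div_rpow ht hA.le,
          Real.exp_neg]
        field_simp

theorem intervalIntegrable_sub_rpow_mul_rpow {α β t : ℝ} (hα : 0 < α) (hβ : 0 ≤ β) :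
    IntervalIntegrable (fun s : ℝ => (t - s) ^ (α - 1) * s ^ β) MeasureTheory.volume 0 t := by
  have h := (intervalIntegral.intervalIntegrable_rpow' (a := 0) (b := t)
    (show -1 < α - 1 by linarith)).comp_sub_left t
  simp only [sub_zero, sub_self] at h
  exact h.symm.mul_continuousOn (Real.continuous_rpow_const hβ).continuousOn

/-- The Riemann-Liouville integral of a power. -/
theorem integral_sub_rpow_mul_rpow {α β t : ℝ} (hα : 0 < α) (hβ : 0 ≤ β) (ht : 0 < t) :
    ∫ s in (0 : ℝ)..t, (t - s) ^ (α - 1) * s ^ β =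
      t ^ (β + α) * (Real.Gamma (β + 1) * Real.Gamma α / Real.Gamma (β + α + 1)) := by
  have h := Complex.betaIntegral_scaled ((β + 1 : ℝ) : ℂ) (α : ℂ) ht
  rw [Complex.betaIntegral_eq_Gamma_mul_div _ _ (by simp; linarith) (by simpa)] at h
  apply Complex.ofReal_injective
  rw [← intervalIntegral.integral_ofReal]
  have e : ((β : ℂ) + 1 + α - 1) = ((β + α : ℝ) : ℂ) := by push_cast; ring
  have e' : ((β : ℂ) + 1 + α) = ((β + α + 1 : ℝ) : ℂ) := by push_cast; ring
  have e'' : ((β : ℂ) + 1) = ((β + 1 : ℝ) : ℂ) := by push_cast; ring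
  calc ∫ s in (0 : ℝ)..t, (((t - s) ^ (α - 1) * s ^ β : ℝ) : ℂ)
      = ∫ s in (0 : ℝ)..t, (s : ℂ) ^ (((β + 1 : ℝ) : ℂ) - 1) * ((t : ℂ) - s) ^ ((α : ℂ) - 1) := by
        refine intervalIntegral.integral_congr fun s hs => ?_
        rw [Set.uIcc_of_le ht.le] at hs
        rw [Complex.ofReal_mul, Complex.ofReal_cpow (sub_nonneg.2 hs.2),
          Complex.ofReal_cpow hs.1, mul_comm]
        push_cast
        ring_nf
    _ = _ := by
        rw [h, Complex.ofReal_add, Complex.ofReal_one, e, e', e'', Complex.Gamma_ofReal,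
          Complex.Gamma_ofReal, Complex.Gamma_ofReal, ← Complex.ofReal_cpow ht.le]
        push_cast
        rfl

/-- The Riemann-Liouville integral acts termwise on a bounded-coefficient Mittag-Leffler series. -/
theorem hasSum_integral_sub_rpow_mul_tsum {α t : ℝ} (hα : 0 < α) (ht : 0 < t) {b : ℕ → ℝ}
    (hb : ∀ k, |b k| ≤ 1) :
    HasSum (fun k : ℕ => Real.Gamma α *
        (b k * (t ^ (((k + 1 : ℕ) : ℝ) * α) / Real.Gamma (((k + 1 : ℕ) : ℝ) * α + 1))))
      (∫ s in (0 : ℝ)..t, (t - s) ^ (α - 1) *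
        ∑' k : ℕ, b k * (s ^ ((k : ℝ) * α) / Real.Gamma ((k : ℝ) * α + 1))) := by
  set F : ℕ → ℝ → ℝ := fun k s =>
    (t - s) ^ (α - 1) * (s ^ ((k : ℝ) * α) / Real.Gamma ((k : ℝ) * α + 1)) with hF
  have hG (k : ℕ) : 0 < Real.Gamma ((k : ℝ) * α + 1) := Real.Gamma_pos_of_pos (by positivity)
  have hFdiv (k : ℕ) : F k = fun s => (t - s) ^ (α - 1) * s ^ ((k : ℝ) * α) /
      Real.Gamma ((k : ℝ) * α + 1) := by
    ext s
    simp only [hF]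
    ring
  have hFint (k : ℕ) : IntervalIntegrable (F k) MeasureTheory.volume 0 t := by
    rw [hFdiv]
    exact (intervalIntegrable_sub_rpow_mul_rpow hα (by positivity)).div_const _
  have hFval (k : ℕ) : ∫ s in (0 : ℝ)..t, F k s = Real.Gamma α *
      (t ^ (((k + 1 : ℕ) : ℝ) * α) / Real.Gamma (((k + 1 : ℕ) : ℝ) * α + 1)) := by
    have e : ((k + 1 : ℕ) : ℝ) * α = k * α + α := by push_cast; ring
    rw [hFdiv, intervalIntegral.integral_div,
      integral_sub_rpow_mul_rpow hα (by positivity) ht, e]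
    field_simp [(hG k).ne']
  have hFnonneg (k : ℕ) {s : ℝ} (hs : s ∈ Set.Ioc 0 t) : 0 ≤ F k s := by
    have := hG k
    have := sub_nonneg.2 hs.2
    have := hs.1.le
    simp only [hF]
    positivity
  have key := MeasureTheory.hasSum_integral_of_summable_integral_norm
    (μ := MeasureTheory.volume.restrict (Set.Ioc 0 t)) (F := fun k s => b k * F k s)
    (fun k => (((intervalIntegrable_iff_integrableOn_Ioc_of_le ht.le).1 (hFint k)).const_mul _))
    (by
      refine Summable.of_nonneg_of_le (fun k => MeasureTheory.integral_nonneg fun s => norm_nonneg _)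
        (fun k => ?_) (((summable_nat_add_iff 1).2
          (summable_rpow_div_Gamma hα ht.le)).mul_left (Real.Gamma α))
      rw [← hFval, intervalIntegral.integral_of_le ht.le]
      have hi := (intervalIntegrable_iff_integrableOn_Ioc_of_le ht.le).1 (hFint k)
      refine MeasureTheory.setIntegral_mono_on (hi.const_mul _).norm hi measurableSet_Ioc
        fun s hs => ?_
      rw [norm_mul, Real.norm_eq_abs, Real.norm_of_nonneg (hFnonneg k hs)]
      exact mul_le_of_le_one_left (hFnonneg k hs) (hb k))
  rw [intervalIntegral.integral_of_le ht.le]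
  have hser (s : ℝ) : (t - s) ^ (α - 1) *
      ∑' k : ℕ, b k * (s ^ ((k : ℝ) * α) / Real.Gamma ((k : ℝ) * α + 1)) =
        ∑' k : ℕ, b k * F k s := by
    rw [← tsum_mul_left]
    congr 1 with k
    simp only [hF]
    ring
  simp only [hser]
  refine key.congr_fun fun k => ?_
  rw [MeasureTheory.integral_const_mul, ← intervalIntegral.integral_of_le ht.le, hFval]
  ring

/-- For `q > 1`, `0 < α ≤ 1`, `λ ∈ ℝ`, the series solution
`y t = λ * ∑' k, a k * t^(kα)/Γ(kα+1)` satisfies the Volterra integral equation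
`y t = λ - (1/Γ(α)) ∫_0^t (t-s)^(α-1) y(s) ds
       + (1/(q Γ(α))) ∫_0^t (t-s)^(α-1) y(s/q) ds` for all `t ≥ 0`. -/
theorem ambartsumian_volterra (q α lam : ℝ) (hq : 1 < q) (hα0 : 0 < α) (hα1 : α ≤ 1)
    (y : ℝ → ℝ)
    (hy : y = fun t : ℝ => lam * ∑' k : ℕ,
      (∏ m ∈ Finset.range k, (q ^ (-(m : ℝ) * α - 1) - 1)) *
        t ^ ((k : ℝ) * α) / Real.Gamma ((k : ℝ) * α + 1)) :
    ∀ t : ℝ, 0 ≤ t →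
      y t = lam - (1 / Real.Gamma α) * (∫ s in (0 : ℝ)..t, (t - s) ^ (α - 1) * y s)
        + (1 / (q * Real.Gamma α)) * ∫ s in (0 : ℝ)..t, (t - s) ^ (α - 1) * y (s / q) := by
  intro t ht
  set a : ℕ → ℝ := fun k => ∏ m ∈ Finset.range k, (q ^ (-(m : ℝ) * α - 1) - 1) with ha
  set g : ℝ → ℕ → ℝ := fun s k => s ^ ((k : ℝ) * α) / Real.Gamma ((k : ℝ) * α + 1) with hg
  have hq0 : 0 < q := one_pos.trans hq
  have hy' (s : ℝ) : y s = lam * ∑' k, a k * g s k := by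
    simp only [hy, ha, hg, mul_div_assoc]
  have hpow (m : ℕ) : q ^ (-(m : ℝ) * α) ≤ 1 :=
    Real.rpow_le_one_of_one_le_of_nonpos hq.le
      (by rw [neg_mul]; exact neg_nonpos.2 (by positivity))
  have hab (k : ℕ) : |a k| ≤ 1 := by
    rw [ha, Finset.abs_prod]
    refine Finset.prod_le_one (fun _ _ => abs_nonneg _) fun m _ => ?_
    have h0 : 0 < q ^ (-(m : ℝ) * α - 1) := by positivity
    have h1 : q ^ (-(m : ℝ) * α - 1) ≤ 1 :=
      (Real.rpow_le_rpow_of_exponent_le hq.le (by linarith)).trans (hpow m)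
    rw [abs_le]
    constructor <;> linarith
  have hsum : Summable fun k => a k * g t k := by
    refine Summable.of_norm_bounded (summable_rpow_div_Gamma hα0 ht) fun k => ?_
    have hG : 0 < Real.Gamma ((k : ℝ) * α + 1) := Real.Gamma_pos_of_pos (by positivity)
    have hgk : 0 ≤ g t k := by simp only [hg]; positivity
    rw [norm_mul, Real.norm_eq_abs, Real.norm_of_nonneg hgk]
    exact mul_le_of_le_one_left hgk (hab k)
  have hsplit : y t = lam + lam * ∑' k, a (k + 1) * g t (k + 1) := by
    rw [hy', hsum.tsum_eq_zero_add]
    simp [ha, hg, mul_add]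
  rcases ht.eq_or_lt with rfl | htpos
  · rw [hsplit]
    simp [hg, Real.zero_rpow (by positivity : ((_ : ℕ) + 1 : ℝ) * α ≠ 0)]
  have hI := hasSum_integral_sub_rpow_mul_tsum hα0 htpos hab
  have hJ := hasSum_integral_sub_rpow_mul_tsum hα0 htpos
    (b := fun k => a k * q ^ (-(k : ℝ) * α)) fun k => by
      rw [abs_mul, abs_of_pos (Real.rpow_pos_of_pos hq0 _)]
      exact mul_le_one₀ (hab k) (by positivity) (hpow k)
  have hyI : ∫ s in (0 : ℝ)..t, (t - s) ^ (α - 1) * y s =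
      lam * ∫ s in (0 : ℝ)..t, (t - s) ^ (α - 1) * ∑' k, a k * g s k := by
    rw [← intervalIntegral.integral_const_mul]
    congr 1 with s
    rw [hy']
    ring
  have hyJ : ∫ s in (0 : ℝ)..t, (t - s) ^ (α - 1) * y (s / q) =
      lam * ∫ s in (0 : ℝ)..t, (t - s) ^ (α - 1) *
        ∑' k, a k * q ^ (-(k : ℝ) * α) * g s k := by
    rw [← intervalIntegral.integral_const_mul]
    refine intervalIntegral.integral_congr fun s hs => ?_
    rw [Set.uIcc_of_le ht] at hs
    have hterm (k : ℕ) : a k * g (s / q) k = a k * q ^ (-(k : ℝ) * α) * g s k := by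
      simp only [hg]
      rw [Real.div_rpow hs.1 hq0.le, neg_mul, Real.rpow_neg hq0.le]
      ring
    simp only [hy', hterm]
    ring
  have hGα : Real.Gamma α ≠ 0 := (Real.Gamma_pos_of_pos hα0).ne'
  have hstep : HasSum (fun k => a (k + 1) * g t (k + 1)) _ :=
    ((hJ.mul_left (1 / (q * Real.Gamma α))).sub (hI.mul_left (1 / Real.Gamma α))).congr_fun
      fun k => by
        have hak : a (k + 1) = a k * (q ^ (-(k : ℝ) * α - 1) - 1) := by
          simp only [ha, Finset.prod_range_succ]
        rw [hak, Real.rpow_sub_one hq0.ne']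
        simp only [hg]
        field_simp
  rw [hsplit, hstep.tsum_eq, hyI, hyJ]
  ring
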